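/- Let n ≥ 1, r ≥ 1, let m : Fin n → Fin r → ℤ be a weight matrix and let i ≠ j be indices in {1,…,n}. Suppose α ∈ ℕ^n satisfies α·m^k = m_{jk} for all 1 ≤ k ≤ r, with α_i ≥ 1, α_j = 0 and |α| ≥ 2, and suppose β ∈ ℕ^n satisfies β·m^k = m_{ik} for all 1 ≤ k ≤ r, with β_j ≥ 1, β_i = 0 and |β| ≥ 2. Then there exists γ ∈ ℕ^n with γ ≠ 0, |γ| ≥ 2, and γ·m^k = 0 for all 1 ≤ k ≤ r. -/

import Mathlib

/-- If `e_i ≤ α`, then pairing `α - e_i` with a weight `w` lowers `α·w` by `w i`. -/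
theorem sum_sub_single_mul {ι : Type*} [Fintype ι] [DecidableEq ι] (α : ι → ℕ) (w : ι → ℤ)
    {i : ι} (hi : 1 ≤ α i) :
    ∑ l, ((α l - (Pi.single i 1 : ι → ℕ) l : ℕ) : ℤ) * w l = ∑ l, (α l : ℤ) * w l - w i := by
  have hle (l : ι) : (Pi.single i 1 : ι → ℕ) l ≤ α l := by
    rcases eq_or_ne l i with rfl | h
    · simpa using hi
    · simp [h]
  simp only [Nat.cast_sub (hle _), sub_mul, Finset.sum_sub_distrib]
  simp [Pi.single_apply]

/-- Given `α ∈ E_j` with `α_i ≥ 1`, `α_j = 0`, `|α| ≥ 2` and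
`β ∈ E_i` with `β_j ≥ 1`, `β_i = 0`, `|β| ≥ 2`, there is a nonzero `γ ∈ ℕ^n`
with `|γ| ≥ 2` and `γ·m^k = 0` for all `k`. -/
theorem stmt_2 (n r : ℕ) (hn : 1 ≤ n) (hr : 1 ≤ r) (m : Fin n → Fin r → ℤ)
    (i j : Fin n) (hij : i ≠ j) (α β : Fin n → ℕ)
    (hα : ∀ k : Fin r, ∑ l, (α l : ℤ) * m l k = m j k)
    (hαi : 1 ≤ α i) (hαj : α j = 0) (hαdeg : 2 ≤ ∑ l, α l)
    (hβ : ∀ k : Fin r, ∑ l, (β l : ℤ) * m l k = m i k)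
    (hβj : 1 ≤ β j) (hβi : β i = 0) (hβdeg : 2 ≤ ∑ l, β l) :
    ∃ γ : Fin n → ℕ, γ ≠ 0 ∧ 2 ≤ ∑ l, γ l ∧
      ∀ k : Fin r, ∑ l, (γ l : ℤ) * m l k = 0 := by
  have hsum (w : Fin n → ℤ) :
      ∑ l, ((α l - (Pi.single i 1 : Fin n → ℕ) l + (β l - (Pi.single j 1 : Fin n → ℕ) l) : ℕ) : ℤ)
        * w l = (∑ l, (α l : ℤ) * w l - w i) + (∑ l, (β l : ℤ) * w l - w j) := by
    simp only [Nat.cast_add, add_mul, Finset.sum_add_distrib, sum_sub_single_mul α w hαi,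
      sum_sub_single_mul β w hβj]
  have hdeg : 2 ≤ ∑ l, (α l - (Pi.single i 1 : Fin n → ℕ) l
      + (β l - (Pi.single j 1 : Fin n → ℕ) l)) := by
    have h := hsum fun _ => 1
    simp only [mul_one, ← Nat.cast_sum] at h
    omega
  refine ⟨fun l => α l - (Pi.single i 1 : Fin n → ℕ) l + (β l - (Pi.single j 1 : Fin n → ℕ) l),
    fun h => ?_, hdeg, fun k => ?_⟩
  · simp only [funext_iff, Pi.zero_apply] at h
    simp [h] at hdeg
  · rw [hsum fun l => m l k, hα, hβ]
    ring
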